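/- arXiv:1207.5619 — 2 statements merged into one kernel-verified Lean document; each statement's English description precedes it below -/
import Mathlib

section
/- Fix Σ ≥ 3. There is a constant C ≥ 1 (depending on Σ) such that for all z = E + iη with |z| ≤ 2Σ, η > 0, and κ = ||E| − 2|, the semicircle Stieltjes transform satisfies C⁻¹ ≤ |m(z)| ≤ C and C⁻¹√(κ + η) ≤ |1 − m(z)²| ≤ C√(κ + η). -/
open MeasureTheory

/-- The semicircle density `ρ(x) = (1/(2π))√((4−x²)₊)`. -/
noncomputable def semicircle (x : ℝ) : ℝ := (2 * Real.pi)⁻¹ * Real.sqrt (max (4 - x ^ 2) 0)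

/-- The Stieltjes transform `m(z) = ∫ ρ(x)/(x − z) dx` of the semicircle law. -/
noncomputable def stieltjes (z : ℂ) : ℂ := ∫ x : ℝ, (semicircle x : ℂ) / ((x : ℂ) - z)

/-- Every point of the upper half-plane is `w + w⁻¹` for some `w` in the punctured unit disc. -/
lemma exists_joukowski_preimage {z : ℂ} (hz : 0 < z.im) :
    ∃ w : ℂ, w ≠ 0 ∧ ‖w‖ < 1 ∧ w ^ 2 - z * w + 1 = 0 := by
  obtain ⟨s, hs⟩ := IsAlgClosed.exists_pow_nat_eq (z ^ 2 - 4) zero_lt_two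
  have hroot : ((z + s) / 2) ^ 2 - z * ((z + s) / 2) + 1 = 0 := by linear_combination hs / 4
  set w := (z + s) / 2
  have hprod : w * (z - w) = 1 := by linear_combination -hroot
  have hnorm : ‖w‖ * ‖z - w‖ = 1 := by rw [← norm_mul, hprod, norm_one]
  have hw0 : w ≠ 0 := left_ne_zero_of_mul_eq_one hprod
  have hw1 : ‖w‖ ≠ 1 := by
    intro h1
    have hinv : z - w = (starRingEnd ℂ) w := by
      rw [← mul_right_inj' hw0, hprod, Complex.mul_conj, Complex.normSq_eq_norm_sq, h1]
      simp
    have := congrArg Complex.im hinv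
    simp only [Complex.sub_im, Complex.conj_im] at this
    linarith
  rcases lt_or_gt_of_ne hw1 with hlt | hgt
  · exact ⟨w, hw0, hlt, hroot⟩
  · refine ⟨z - w, right_ne_zero_of_mul_eq_one hprod, ?_, by linear_combination hroot⟩
    nlinarith [norm_nonneg (z - w)]

lemma two_mul_cos_sub_ne_zero {z : ℂ} (hz : 0 < z.im) (x : ℝ) :
    ((2 * Real.cos x : ℝ) : ℂ) - z ≠ 0 := by
  intro h
  have := congrArg Complex.im h
  simp only [Complex.sub_im, Complex.ofReal_im, Complex.zero_im] at this
  linarith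

lemma integral_inv_two_mul_cos_sub {z w : ℂ} (hz : 0 < z.im) (hw0 : w ≠ 0) (hw : ‖w‖ < 1)
    (h : w ^ 2 - z * w + 1 = 0) :
    ∫ θ in (0 : ℝ)..2 * Real.pi, (((2 * Real.cos θ : ℝ) : ℂ) - z)⁻¹ =
      -(2 * Real.pi * w / (1 - w ^ 2)) := by
  have hne : ∀ u ∈ Metric.closedBall (0 : ℂ) 1, 1 - w * u ≠ 0 := by
    intro u hu h0
    have hu' : ‖u‖ ≤ 1 := by simpa using hu
    have : ‖w * u‖ = 1 := by rw [← sub_eq_zero.1 h0, norm_one]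
    rw [norm_mul] at this
    nlinarith [norm_nonneg w, norm_nonneg u]
  have hd : DifferentiableOn ℂ (fun u : ℂ => (1 - w * u)⁻¹) (Metric.closedBall 0 1) := by
    intro u hu
    have : DifferentiableAt ℂ (fun u : ℂ => 1 - w * u) u := by fun_prop
    exact (this.inv (hne u hu)).differentiableWithinAt
  have hc := hd.circleIntegral_sub_inv_smul (w := w) (by simpa using hw)
  rw [circleIntegral] at hc
  have hpt : ∀ θ : ℝ, deriv (circleMap 0 1) θ •
      ((circleMap 0 1 θ - w)⁻¹ • (1 - w * circleMap 0 1 θ)⁻¹) =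
      (-Complex.I / w) * (((2 * Real.cos θ : ℝ) : ℂ) - z)⁻¹ := by
    intro θ
    have h1 := hne (circleMap 0 1 θ) (circleMap_mem_closedBall 0 zero_le_one θ)
    have h2 : circleMap 0 1 θ - w ≠ 0 :=
      sub_ne_zero.2 (circleMap_ne_mem_ball (by simpa using hw) θ)
    have h3 := two_mul_cos_sub_ne_zero hz θ
    have h4 : circleMap 0 1 θ ≠ 0 := circleMap_ne_center one_ne_zero
    have h5 : circleMap 0 1 θ * ((2 * Real.cos θ : ℝ) : ℂ) = circleMap 0 1 θ ^ 2 + 1 := by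
      have : Complex.exp (θ * Complex.I) * Complex.exp (-θ * Complex.I) = 1 := by
        rw [← Complex.exp_add]; simp
      simp only [circleMap, Complex.ofReal_mul, Complex.ofReal_cos, Complex.cos]
      push_cast
      linear_combination this
    rw [deriv_circleMap]
    simp only [smul_eq_mul]
    generalize circleMap 0 1 θ = u at *
    generalize ((2 * Real.cos θ : ℝ) : ℂ) = c at *
    have h1' : 1 - u * w ≠ 0 := by rwa [mul_comm]
    field_simp
    linear_combination w * h5 + u * h
  simp only [hpt] at hc
  rw [intervalIntegral.integral_const_mul] at hc
  have h1 : 1 - w ^ 2 ≠ 0 := by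
    have := hne w (by simpa using hw.le)
    rwa [pow_two]
  simp only [smul_eq_mul] at hc
  generalize (∫ θ in (0 : ℝ)..2 * Real.pi, (((2 * Real.cos θ : ℝ) : ℂ) - z)⁻¹) = J at *
  have hI := Complex.I_ne_zero
  rw [← pow_two] at hc
  field_simp at hc ⊢
  linear_combination -hc

lemma stieltjes_eq_integral_cos {z : ℂ} (hz : 0 < z.im) :
    stieltjes z = (2 * Real.pi : ℂ)⁻¹ * ∫ θ in (0 : ℝ)..Real.pi,
      (4 - ((2 * Real.cos θ : ℝ) : ℂ) ^ 2) / (((2 * Real.cos θ : ℝ) : ℂ) - z) := by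
  set g : ℝ → ℂ := fun x => (semicircle x : ℂ) / ((x : ℂ) - z) with hg
  have hgc : Continuous g := by
    refine Continuous.div ?_ (by fun_prop) ?_
    · unfold semicircle; fun_prop
    · intro x h
      have := congrArg Complex.im h
      simp only [Complex.sub_im, Complex.ofReal_im, Complex.zero_im] at this
      linarith
  have h1 : stieltjes z = ∫ x in (-2 : ℝ)..2, g x := by
    rw [intervalIntegral.integral_of_le (by norm_num)]
    refine (setIntegral_eq_integral_of_forall_compl_eq_zero fun x hx => ?_).symm
    have : 4 - x ^ 2 ≤ 0 := by
      by_contra! hc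
      exact hx ⟨by nlinarith, by nlinarith⟩
    simp [semicircle, max_eq_right this]
  have h2 := intervalIntegral.integral_deriv_smul_comp (a := 0) (b := Real.pi)
    (f := fun θ => 2 * Real.cos θ) (f' := fun θ => 2 * -Real.sin θ) (g := g)
    (fun θ _ => (Real.hasDerivAt_cos θ).const_mul 2) (by fun_prop) hgc
  simp only [Real.cos_zero, Real.cos_pi, mul_one, mul_neg] at h2
  rw [h1, intervalIntegral.integral_symm, ← h2, ← intervalIntegral.integral_neg,
    ← intervalIntegral.integral_const_mul]
  refine intervalIntegral.integral_congr fun θ hθ => ?_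
  rw [Set.uIcc_of_le Real.pi_pos.le] at hθ
  have hs := Real.sin_nonneg_of_mem_Icc hθ
  have h4 : 4 - (2 * Real.cos θ) ^ 2 = (2 * Real.sin θ) ^ 2 := by
    nlinarith [Real.sin_sq_add_cos_sq θ]
  have h5 : semicircle (2 * Real.cos θ) = (2 * Real.pi)⁻¹ * (2 * Real.sin θ) := by
    rw [semicircle, h4, max_eq_left (sq_nonneg _), Real.sqrt_sq (by positivity)]
  have h6 : (4 - ((2 * Real.cos θ : ℝ) : ℂ) ^ 2) = ((2 * Real.sin θ : ℝ) : ℂ) ^ 2 := by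
    exact_mod_cast h4
  simp only [hg, Function.comp, h5, h6, Complex.real_smul]
  push_cast
  ring

lemma two_mul_integral_zero_pi_comp_cos {f : ℝ → ℂ} (hf : Continuous fun θ => f (Real.cos θ)) :
    2 * ∫ θ in (0 : ℝ)..Real.pi, f (Real.cos θ) =
      ∫ θ in (0 : ℝ)..2 * Real.pi, f (Real.cos θ) := by
  rw [← intervalIntegral.integral_add_adjacent_intervals (hf.intervalIntegrable 0 Real.pi)
    (hf.intervalIntegrable Real.pi (2 * Real.pi))]
  have := intervalIntegral.integral_comp_sub_left (a := Real.pi) (b := 2 * Real.pi)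
    (fun θ => f (Real.cos θ)) (2 * Real.pi)
  simp only [Real.cos_two_pi_sub, sub_self] at this
  rw [this, two_mul, two_mul, add_sub_cancel_right]

/-- The self-consistent equation of the semicircle law. -/
lemma stieltjes_sq_add_mul_add_one {z : ℂ} (hz : 0 < z.im) :
    stieltjes z ^ 2 + z * stieltjes z + 1 = 0 := by
  obtain ⟨w, hw0, hw, h⟩ := exists_joukowski_preimage hz
  suffices hm : stieltjes z = -w by
    rw [hm]; linear_combination h
  have hne := two_mul_cos_sub_ne_zero hz
  have hinv : Continuous fun θ : ℝ => (((2 * Real.cos θ : ℝ) : ℂ) - z)⁻¹ :=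
    Continuous.inv₀ (by fun_prop) hne
  have h1 := two_mul_integral_zero_pi_comp_cos
    (f := fun c => (4 - ((2 * c : ℝ) : ℂ) ^ 2) / (((2 * c : ℝ) : ℂ) - z))
    (Continuous.div (by fun_prop) (by fun_prop) hne)
  have h2 : ∀ θ : ℝ, (4 - ((2 * Real.cos θ : ℝ) : ℂ) ^ 2) / (((2 * Real.cos θ : ℝ) : ℂ) - z) =
      -(((2 * Real.cos θ : ℝ) : ℂ) + z) + (4 - z ^ 2) * (((2 * Real.cos θ : ℝ) : ℂ) - z)⁻¹ := by
    intro θ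
    have := hne θ
    field_simp
    ring
  have hcos : ∫ θ in (0 : ℝ)..2 * Real.pi, ((2 * Real.cos θ : ℝ) : ℂ) = 0 := by
    rw [intervalIntegral.integral_ofReal]
    simp
  have h3 : ∫ θ in (0 : ℝ)..2 * Real.pi,
      (4 - ((2 * Real.cos θ : ℝ) : ℂ) ^ 2) / (((2 * Real.cos θ : ℝ) : ℂ) - z) =
      -(2 * Real.pi * z) + (4 - z ^ 2) * -(2 * Real.pi * w / (1 - w ^ 2)) := by
    simp only [h2]
    rw [intervalIntegral.integral_add (Continuous.intervalIntegrable (by fun_prop) _ _)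
      (Continuous.intervalIntegrable (by fun_prop) _ _), intervalIntegral.integral_neg,
      intervalIntegral.integral_add (Continuous.intervalIntegrable (by fun_prop) _ _)
      (Continuous.intervalIntegrable (by fun_prop) _ _), hcos,
      intervalIntegral.integral_const_mul, integral_inv_two_mul_cos_sub hz hw0 hw h]
    simp
  have hpi : (Real.pi : ℂ) ≠ 0 := by exact_mod_cast Real.pi_ne_zero
  have hw2 : 1 - w ^ 2 ≠ 0 := by
    intro h0
    have : ‖w‖ ^ 2 = 1 := by rw [← norm_pow, ← sub_eq_zero.1 h0, norm_one]
    nlinarith [norm_nonneg w]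
  have hzw : z = w + w⁻¹ := by
    field_simp
    linear_combination -h
  rw [stieltjes_eq_integral_cos hz]
  rw [h3] at h1
  generalize (∫ θ in (0 : ℝ)..Real.pi, (4 - ((2 * Real.cos θ : ℝ) : ℂ) ^ 2) /
    (((2 * Real.cos θ : ℝ) : ℂ) - z)) = J at *
  have h4 : J = -(2 * Real.pi * w) := by
    rw [← mul_right_inj' (two_ne_zero (α := ℂ)), h1, hzw]
    field_simp
    ring
  rw [h4]
  field_simp

lemma norm_sq_sub_four_bounds {z : ℂ} {R : ℝ} (hR : 2 ≤ R) (hzR : ‖z‖ ≤ R) (hz : 0 ≤ z.im) :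
    |(|z.re| - 2)| + z.im ≤ ‖z ^ 2 - 4‖ ∧
      ‖z ^ 2 - 4‖ ≤ 2 * R * (|(|z.re| - 2)| + z.im) := by
  have hfac : ‖z ^ 2 - 4‖ = ‖z - 2‖ * ‖z + 2‖ := by
    rw [← norm_mul]; ring_nf
  have htri : ‖z + 2‖ ≤ 2 * R ∧ ‖z - 2‖ ≤ 2 * R := by
    constructor
    · exact (norm_add_le _ _).trans (by norm_num; linarith)
    · exact (norm_sub_le _ _).trans (by norm_num; linarith)
  have hsum : ∀ x y : ℝ, 0 ≤ y →
      ‖(⟨x, y⟩ : ℂ)‖ ≤ |x| + y ∧ |x| + y ≤ 2 * ‖(⟨x, y⟩ : ℂ)‖ := by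
    intro x y hy
    have h1 := Complex.norm_le_abs_re_add_abs_im ⟨x, y⟩
    have h2 := Complex.abs_re_le_norm ⟨x, y⟩
    have h3 := Complex.abs_im_le_norm ⟨x, y⟩
    simp only [abs_of_nonneg hy] at h1 h3
    exact ⟨h1, by simp only at h2; linarith⟩
  have em : z - 2 = ⟨z.re - 2, z.im⟩ := by apply Complex.ext <;> simp
  have ep : z + 2 = ⟨z.re + 2, z.im⟩ := by apply Complex.ext <;> simp
  have hm := hsum (z.re - 2) z.im hz
  have hp := hsum (z.re + 2) z.im hz
  rw [← em] at hm
  rw [← ep] at hp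
  have hrm := Complex.abs_re_le_norm (z - 2)
  have hrp := Complex.abs_re_le_norm (z + 2)
  simp only [Complex.sub_re, Complex.add_re, Complex.re_ofNat] at hrm hrp
  have n1 := norm_nonneg (z - 2)
  have n2 := norm_nonneg (z + 2)
  rw [hfac]
  rcases le_total 0 z.re with h0 | h0
  · rw [abs_of_nonneg h0]
    have : 2 ≤ ‖z + 2‖ := by linarith [le_abs_self (z.re + 2)]
    constructor <;> nlinarith
  · have e : |(|z.re| - 2)| = |z.re + 2| := by
      rw [abs_of_nonpos h0, ← abs_neg]; ring_nf
    rw [e]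
    have : 2 ≤ ‖z - 2‖ := by linarith [neg_le_abs (z.re - 2)]
    constructor <;> nlinarith

/-- For `|z| ≤ 2Σ` with `η = Im z > 0` and `κ = ||Re z| − 2|`:
`|m(z)| ≍ 1` and `|1 − m(z)²| ≍ √(κ + η)`. -/
theorem stieltjes_bounds (Sig : ℝ) (hSig : 3 ≤ Sig) :
    ∃ C : ℝ, 1 ≤ C ∧ ∀ z : ℂ, ‖z‖ ≤ 2 * Sig → 0 < z.im →
      (C⁻¹ ≤ ‖stieltjes z‖ ∧ ‖stieltjes z‖ ≤ C) ∧
      (C⁻¹ * Real.sqrt (|(|z.re| - 2)| + z.im) ≤ ‖1 - stieltjes z ^ 2‖ ∧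
        ‖1 - stieltjes z ^ 2‖ ≤ C * Real.sqrt (|(|z.re| - 2)| + z.im)) := by
  have hK : 1 ≤ 2 * Sig + 1 := by linarith
  refine ⟨(2 * Sig + 1) ^ 2, one_le_pow₀ hK, fun z hzR hz => ?_⟩
  have hq := stieltjes_sq_add_mul_add_one hz
  obtain ⟨hlo, hhi⟩ := norm_sq_sub_four_bounds (by linarith) hzR hz.le
  generalize stieltjes z = m at *
  set K := 2 * Sig + 1 with hKdef
  have hKK : K ≤ K ^ 2 := by nlinarith
  have hprod : ‖m‖ * ‖m + z‖ = 1 := by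
    rw [← norm_mul, show m * (m + z) = -1 by linear_combination hq]; simp
  have hmz : ‖m + z‖ ≤ ‖m‖ + 2 * Sig := (norm_add_le _ _).trans (by linarith)
  have hmz' : ‖m‖ - 2 * Sig ≤ ‖m + z‖ := by
    have := norm_sub_le (m + z) z
    rw [add_sub_cancel_right] at this
    linarith
  have hm0 := norm_nonneg m
  have hupper : ‖m‖ ≤ K := by
    by_contra! hc
    nlinarith
  have hlower : K⁻¹ ≤ ‖m‖ := by
    rw [inv_le_iff_one_le_mul₀ (by linarith)]
    by_contra! hc
    have hm1 : ‖m‖ < 1 := by nlinarith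
    have : ‖m‖ * ‖m + z‖ ≤ ‖m‖ * K := mul_le_mul_of_nonneg_left (by linarith) hm0
    linarith
  have hsq : ‖1 - m ^ 2‖ = ‖m‖ * Real.sqrt ‖z ^ 2 - 4‖ := by
    rw [← Real.sqrt_sq hm0, ← Real.sqrt_mul (sq_nonneg _), ← norm_pow, ← norm_mul,
      show m ^ 2 * (z ^ 2 - 4) = (1 - m ^ 2) ^ 2 by
        linear_combination (z * m - m ^ 2 - 1) * hq, norm_pow, Real.sqrt_sq (norm_nonneg _)]
  have hinv : (K ^ 2)⁻¹ ≤ K⁻¹ := inv_anti₀ (by linarith) hKK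
  refine ⟨⟨hinv.trans hlower, hupper.trans hKK⟩, ?_, ?_⟩
  · rw [hsq]
    exact mul_le_mul (hinv.trans hlower) (Real.sqrt_le_sqrt hlo) (Real.sqrt_nonneg _) hm0
  · have hs : Real.sqrt ‖z ^ 2 - 4‖ ≤ K * Real.sqrt (|(|z.re| - 2)| + z.im) := by
      rw [← Real.sqrt_sq (by linarith : 0 ≤ K), ← Real.sqrt_mul (sq_nonneg _)]
      refine Real.sqrt_le_sqrt (hhi.trans ?_)
      have : 0 ≤ |(|z.re| - 2)| + z.im := by positivity
      exact mul_le_mul_of_nonneg_right (by nlinarith) this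
    rw [hsq, pow_two K, mul_assoc]
    exact mul_le_mul hupper hs (Real.sqrt_nonneg _) (by linarith)
end

section
/- Let N = n + m and let A, B be Hermitian N×N matrices with A = diag(A₁₁, A₂₂) block diagonal (A₁₁ of size n, A₂₂ of size m) and B purely off-diagonal in this block decomposition (B₁₁ = 0, B₂₂ = 0). Set Δ = dist(σ(A₁₁), σ(A₂₂)) and assume Δ ≥ 3‖B‖ and B ≠ 0. Define D = {μ ∈ ℝ : dist(μ, σ(A₁₁)) < 2‖B‖}. Then A + B has exactly n eigenvalues μ₁ ≤ … ≤ μₙ in D (with multiplicity), and |μᵢ − λᵢ(A₁₁)| ≤ ‖B‖²/(Δ − 2‖B‖) for each i = 1,…,n, where λ₁(A₁₁) ≤ … ≤ λₙ(A₁₁) are the ordered eigenvalues of A₁₁. -/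
open Matrix

/-- The `ℓ² → ℓ²` operator norm of a (rectangular) complex matrix. -/
noncomputable def opNorm {α β : Type*} [Fintype α] [Fintype β] [DecidableEq β]
    (M : Matrix α β ℂ) : ℝ :=
  ‖LinearMap.toContinuousLinearMap (Matrix.toEuclideanLin M)‖

open scoped InnerProductSpace

section
variable {ι E : Type*} [Fintype ι] [NormedAddCommGroup E] [InnerProductSpace ℂ E]

lemma re_inner_eq_sum_of_eigenbasis (v : OrthonormalBasis ι ℂ E) {a : ι → ℝ} {T : E →ₗ[ℂ] E}
    (hT : ∀ i, T (v i) = (a i : ℂ) • v i) (x : E) :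
    (⟪x, T x⟫_ℂ).re = ∑ i, a i * ‖⟪v i, x⟫_ℂ‖ ^ 2 := by
  have hTx : T x = ∑ i, ⟪v i, x⟫_ℂ • (a i : ℂ) • v i := by
    conv_lhs => rw [← v.sum_repr' x]
    simp only [map_sum, map_smul, hT]
  simp only [hTx, inner_sum, inner_smul_right, Complex.re_sum]
  refine Finset.sum_congr rfl fun i _ => ?_
  rw [← inner_conj_symm x (v i), mul_left_comm, Complex.mul_conj, Complex.normSq_eq_norm_sq]
  norm_cast

lemma exists_submodule_re_inner_le (v : OrthonormalBasis ι ℂ E) {a : ι → ℝ} {T : E →ₗ[ℂ] E}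
    (hT : ∀ i, T (v i) = (a i : ℂ) • v i) (c : ℝ) :
    ∃ W : Submodule ℂ E, Module.finrank ℂ W = Fintype.card {i // a i ≤ c} ∧
      ∀ x ∈ W, (⟪x, T x⟫_ℂ).re ≤ c * ‖x‖ ^ 2 := by
  refine ⟨Submodule.span ℂ (Set.range fun i : {i // a i ≤ c} => v i),
    finrank_span_eq_card (v.orthonormal.linearIndependent.comp _ Subtype.val_injective),
    fun x hx => ?_⟩
  have hzero : ∀ i, ¬ a i ≤ c → ⟪v i, x⟫_ℂ = 0 := by
    intro i hi
    induction hx using Submodule.span_induction with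
    | mem y hy =>
      obtain ⟨j, rfl⟩ := hy
      exact v.orthonormal.2 fun h => hi (h ▸ j.2)
    | zero => simp
    | add y z _ _ hy hz => simp [hy, hz]
    | smul r y _ hy => simp [hy]
  rw [re_inner_eq_sum_of_eigenbasis v hT, ← v.sum_sq_norm_inner_right x, Finset.mul_sum]
  refine Finset.sum_le_sum fun i _ => ?_
  by_cases hi : a i ≤ c
  · gcongr
  · simp [hzero i hi]

lemma finrank_le_card_eigenvalues_le {V : Type*} [AddCommGroup V] [Module ℂ V]
    [FiniteDimensional ℂ V] (v : OrthonormalBasis ι ℂ E) {a : ι → ℝ} {T : E →ₗ[ℂ] E}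
    (hT : ∀ i, T (v i) = (a i : ℂ) • v i) (c : ℝ) (S : V →ₗ[ℂ] E) (hS : ∀ x, S x = 0 → x = 0)
    (hform : ∀ x, (⟪S x, T (S x)⟫_ℂ).re ≤ c * ‖S x‖ ^ 2) :
    Module.finrank ℂ V ≤ Fintype.card {i // a i ≤ c} := by
  by_contra! hlt
  let R : V →ₗ[ℂ] ({i // a i ≤ c} → ℂ) :=
    LinearMap.pi fun i => (innerₛₗ ℂ (v i)) ∘ₗ S
  have hker : LinearMap.ker R ≠ ⊥ := LinearMap.ker_ne_bot_of_finrank_lt (by simpa using hlt)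
  obtain ⟨x, hx, hx0⟩ := Submodule.exists_mem_ne_zero_of_ne_bot hker
  have hzero : ∀ i, a i ≤ c → ⟪v i, S x⟫_ℂ = 0 := fun i hi => congrFun hx ⟨i, hi⟩
  have hle := hform x
  rw [re_inner_eq_sum_of_eigenbasis v hT, ← v.sum_sq_norm_inner_right (S x), Finset.mul_sum,
    ← not_lt] at hle
  have hne : ∃ i, ⟪v i, S x⟫_ℂ ≠ 0 := by
    by_contra! h
    exact hx0 (hS x (by rw [← v.sum_repr' (S x)]; simp [h]))
  obtain ⟨i, hi⟩ := hne
  refine hle (Finset.sum_lt_sum (fun j _ => ?_) ⟨i, Finset.mem_univ i, ?_⟩)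
  · by_cases hj : a j ≤ c
    · simp [hzero j hj]
    · gcongr
      exact (not_le.mp hj).le
  · have : c < a i := not_le.mp fun h => hi (hzero i h)
    have : 0 < ‖⟪v i, S x⟫_ℂ‖ := norm_pos_iff.mpr hi
    gcongr

lemma exists_resolvent (v : OrthonormalBasis ι ℂ E) {a : ι → ℝ} {T : E →ₗ[ℂ] E}
    (hT : ∀ i, T (v i) = (a i : ℂ) • v i) {c g : ℝ} (hg : 0 < g) (hgap : ∀ i, g ≤ |a i - c|) :
    ∃ G : E →ₗ[ℂ] E, (∀ x, T (G x) - (c : ℂ) • G x = x) ∧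
      ∀ x, -(⟪x, G x⟫_ℂ).re ≤ ‖x‖ ^ 2 / g := by
  let G : E →ₗ[ℂ] E := v.toBasis.constr ℂ fun i => (((a i - c)⁻¹ : ℝ) : ℂ) • v i
  have hG : ∀ i, G (v i) = (((a i - c)⁻¹ : ℝ) : ℂ) • v i := fun i => by
    simpa only [OrthonormalBasis.coe_toBasis] using
      v.toBasis.constr_basis ℂ (fun i => (((a i - c)⁻¹ : ℝ) : ℂ) • v i) i
  refine ⟨G, fun x => ?_, fun x => ?_⟩
  · have : T ∘ₗ G - (c : ℂ) • G = LinearMap.id := by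
      refine v.toBasis.ext fun i => ?_
      have hne : ((a i : ℂ) - c) ≠ 0 := by
        have := hg.trans_le (hgap i)
        exact_mod_cast abs_pos.mp this
      simp only [OrthonormalBasis.coe_toBasis, LinearMap.sub_apply, LinearMap.comp_apply,
        LinearMap.smul_apply, hG, map_smul, hT, smul_smul, ← sub_smul, LinearMap.id_apply]
      push_cast
      rw [mul_comm (c : ℂ), ← mul_sub, inv_mul_cancel₀ hne, one_smul]
    exact LinearMap.congr_fun this x
  · rw [re_inner_eq_sum_of_eigenbasis v hG, ← v.sum_sq_norm_inner_right x, Finset.sum_div,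
      ← Finset.sum_neg_distrib]
    refine Finset.sum_le_sum fun i _ => ?_
    have h : -(a i - c)⁻¹ ≤ g⁻¹ := by
      refine (neg_le_abs _).trans ?_
      rw [abs_inv]
      exact inv_anti₀ hg (hgap i)
    rw [← neg_mul, div_eq_inv_mul]
    gcongr

end

section
variable {ι α β H E₁ E₂ : Type*} [Fintype ι] [Fintype α] [Fintype β]
  [NormedAddCommGroup H] [InnerProductSpace ℂ H]
  [NormedAddCommGroup E₁] [InnerProductSpace ℂ E₁]
  [NormedAddCommGroup E₂] [InnerProductSpace ℂ E₂]

/-- `T` is represented by the block operator with diagonal blocks `A₁`, `A₂` and lower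
off-diagonal block `C`, through the isometry `J`, as far as quadratic forms are concerned. -/
structure IsBlockForm (J : E₁ × E₂ →ₗ[ℂ] H) (T : H →ₗ[ℂ] H) (A₁ : E₁ →ₗ[ℂ] E₁)
    (A₂ : E₂ →ₗ[ℂ] E₂) (C : E₁ →ₗ[ℂ] E₂) : Prop where
  norm_sq : ∀ x y, ‖J (x, y)‖ ^ 2 = ‖x‖ ^ 2 + ‖y‖ ^ 2
  re_inner : ∀ x y, (⟪J (x, y), T (J (x, y))⟫_ℂ).re =
    (⟪x, A₁ x⟫_ℂ).re + (⟪y, A₂ y⟫_ℂ).re + 2 * (⟪y, C x⟫_ℂ).re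

variable {J : E₁ × E₂ →ₗ[ℂ] H} {T : H →ₗ[ℂ] H} {A₁ : E₁ →ₗ[ℂ] E₁} {A₂ : E₂ →ₗ[ℂ] E₂}
  {C : E₁ →ₗ[ℂ] E₂}

lemma IsBlockForm.neg (h : IsBlockForm J T A₁ A₂ C) : IsBlockForm J (-T) (-A₁) (-A₂) (-C) where
  norm_sq := h.norm_sq
  re_inner x y := by
    simp only [LinearMap.neg_apply, inner_neg_right, Complex.neg_re, h.re_inner]
    ring

lemma IsBlockForm.eq_zero (h : IsBlockForm J T A₁ A₂ C) {x : E₁} {y : E₂}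
    (h0 : J (x, y) = 0) : x = 0 ∧ y = 0 := by
  have := h.norm_sq x y
  rw [h0, norm_zero] at this
  constructor <;> rw [← norm_eq_zero] <;> nlinarith [sq_nonneg ‖x‖, sq_nonneg ‖y‖]

variable {t : ι → ℝ} {a : α → ℝ} {d : β → ℝ}

/-- One half of Weyl's inequality, as a comparison of eigenvalue counting functions. -/
lemma card_add_card_le_of_isBlockForm (h : IsBlockForm J T A₁ A₂ C)
    (v : OrthonormalBasis ι ℂ H) (hT : ∀ i, T (v i) = (t i : ℂ) • v i)
    (v₁ : OrthonormalBasis α ℂ E₁) (hA₁ : ∀ i, A₁ (v₁ i) = (a i : ℂ) • v₁ i)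
    (v₂ : OrthonormalBasis β ℂ E₂) (hA₂ : ∀ i, A₂ (v₂ i) = (d i : ℂ) • v₂ i)
    {b : ℝ} (hC : ∀ x, ‖C x‖ ≤ b * ‖x‖) (hb : 0 ≤ b) (c : ℝ) :
    Fintype.card {i // a i ≤ c} + Fintype.card {j // d j ≤ c} ≤
      Fintype.card {i // t i ≤ c + b} := by
  have : FiniteDimensional ℂ E₁ := v₁.toBasis.finiteDimensional_of_finite
  have : FiniteDimensional ℂ E₂ := v₂.toBasis.finiteDimensional_of_finite
  obtain ⟨W₁, hW₁, hq₁⟩ := exists_submodule_re_inner_le v₁ hA₁ c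
  obtain ⟨W₂, hW₂, hq₂⟩ := exists_submodule_re_inner_le v₂ hA₂ c
  rw [← hW₁, ← hW₂, ← Module.finrank_prod]
  refine finrank_le_card_eigenvalues_le v hT _ (J ∘ₗ W₁.subtype.prodMap W₂.subtype) ?_ ?_
  · rintro ⟨x, y⟩ h0
    simpa using h.eq_zero h0
  · rintro ⟨⟨x, hx⟩, ⟨y, hy⟩⟩
    change (⟪J (x, y), T (J (x, y))⟫_ℂ).re ≤ (c + b) * ‖J (x, y)‖ ^ 2
    rw [h.norm_sq, h.re_inner]
    have h1 := hq₁ x hx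
    have h2 := hq₂ y hy
    have h3 : (⟪y, C x⟫_ℂ).re ≤ ‖y‖ * (b * ‖x‖) :=
      (re_inner_le_norm (𝕜 := ℂ) y (C x)).trans (mul_le_mul_of_nonneg_left (hC x) (norm_nonneg y))
    nlinarith [mul_nonneg hb (sq_nonneg (‖x‖ - ‖y‖))]

/-- One half of Haynsworth's inertia additivity, combined with a bound on the Schur complement. -/
lemma card_add_card_le_of_isBlockForm_of_gap (h : IsBlockForm J T A₁ A₂ C)
    (v : OrthonormalBasis ι ℂ H) (hT : ∀ i, T (v i) = (t i : ℂ) • v i)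
    (v₁ : OrthonormalBasis α ℂ E₁) (hA₁ : ∀ i, A₁ (v₁ i) = (a i : ℂ) • v₁ i)
    (v₂ : OrthonormalBasis β ℂ E₂) (hA₂ : ∀ i, A₂ (v₂ i) = (d i : ℂ) • v₂ i)
    (hsymm : A₂.IsSymmetric) {b : ℝ} (hC : ∀ x, ‖C x‖ ≤ b * ‖x‖)
    {c g : ℝ} (hg : 0 < g) (hgap : ∀ j, g ≤ |d j - (c + b ^ 2 / g)|) :
    Fintype.card {i // a i ≤ c} + Fintype.card {j // d j ≤ c + b ^ 2 / g} ≤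
      Fintype.card {i // t i ≤ c + b ^ 2 / g} := by
  have : FiniteDimensional ℂ E₁ := v₁.toBasis.finiteDimensional_of_finite
  have : FiniteDimensional ℂ E₂ := v₂.toBasis.finiteDimensional_of_finite
  obtain ⟨W₁, hW₁, hq₁⟩ := exists_submodule_re_inner_le v₁ hA₁ c
  obtain ⟨W₂, hW₂, hq₂⟩ := exists_submodule_re_inner_le v₂ hA₂ (c + b ^ 2 / g)
  obtain ⟨G, hG, hGle⟩ := exists_resolvent v₂ hA₂ hg hgap
  rw [← hW₁, ← hW₂, ← Module.finrank_prod]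
  let S : W₁ × W₂ →ₗ[ℂ] E₁ × E₂ :=
    (W₁.subtype ∘ₗ LinearMap.fst ℂ W₁ W₂).prod
      (W₂.subtype ∘ₗ LinearMap.snd ℂ W₁ W₂ - G ∘ₗ C ∘ₗ W₁.subtype ∘ₗ LinearMap.fst ℂ W₁ W₂)
  refine finrank_le_card_eigenvalues_le v hT _ (J ∘ₗ S) ?_ ?_
  · rintro ⟨⟨x, hx⟩, ⟨y, hy⟩⟩ h0
    change J (x, y - G (C x)) = 0 at h0
    obtain ⟨rfl, h2⟩ := h.eq_zero h0
    simpa using h2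
  · rintro ⟨⟨x, hx⟩, ⟨y, hy⟩⟩
    change (⟪J (x, y - G (C x)), T (J (x, y - G (C x)))⟫_ℂ).re ≤
      (c + b ^ 2 / g) * ‖J (x, y - G (C x))‖ ^ 2
    rw [h.norm_sq, h.re_inner]
    have h1 := hq₁ x hx
    have h2 := hq₂ y hy
    have h3 : ‖C x‖ ^ 2 / g ≤ b ^ 2 / g * ‖x‖ ^ 2 := by
      rw [div_mul_eq_mul_div, ← mul_pow]
      gcongr
      exact hC x
    have h4 := hGle (C x)
    set e := c + b ^ 2 / g
    set w := C x
    set z := G w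
    have hz : A₂ z = w + (e : ℂ) • z := by rw [← hG w]; abel
    have hzy : (⟪z, A₂ y⟫_ℂ).re = (⟪y, w⟫_ℂ).re + e * (⟪y, z⟫_ℂ).re := by
      rw [← hsymm z y, hz, inner_add_left, inner_smul_left, ← inner_conj_symm w y,
        ← inner_conj_symm z y]
      simp only [Complex.conj_ofReal, Complex.add_re, Complex.re_ofReal_mul, Complex.conj_re]
    have hn : ‖y - z‖ ^ 2 = ‖y‖ ^ 2 - 2 * (⟪y, z⟫_ℂ).re + ‖z‖ ^ 2 := norm_sub_sq (𝕜 := ℂ) y z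
    have hzz : (⟪z, z⟫_ℂ).re = ‖z‖ ^ 2 := inner_self_eq_norm_sq (𝕜 := ℂ) z
    have hzw : (⟪z, w⟫_ℂ).re = (⟪w, z⟫_ℂ).re := inner_re_symm (𝕜 := ℂ) z w
    rw [hn]
    simp only [map_sub, inner_sub_left, inner_sub_right, Complex.sub_re, hz, inner_add_right,
      inner_smul_right, Complex.add_re, Complex.re_ofReal_mul, hzz, hzw, hzy]
    have : e * ‖x‖ ^ 2 = c * ‖x‖ ^ 2 + b ^ 2 / g * ‖x‖ ^ 2 := by ring
    linarith

end

section counting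

lemma apply_le_add_of_card_le {N : ℕ} {u v : Fin N → ℝ} (hu : Monotone u) (hv : Monotone v)
    {δ : ℝ} {k : Fin N} (h : Fintype.card {i // u i ≤ u k} ≤ Fintype.card {i // v i ≤ u k + δ}) :
    v k ≤ u k + δ := by
  by_contra! hlt
  have h1 : (Finset.Iic k).card ≤ Fintype.card {i // u i ≤ u k} := by
    rw [Fintype.card_subtype]
    exact Finset.card_le_card fun i hi => by simpa using hu (Finset.mem_Iic.mp hi)
  have h2 : Fintype.card {i // v i ≤ u k + δ} ≤ (Finset.Iio k).card := by
    rw [Fintype.card_subtype]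
    refine Finset.card_le_card fun i hi => Finset.mem_Iio.mpr ?_
    by_contra! hik
    have := hv hik
    have := (Finset.mem_filter.mp hi).2
    linarith
  rw [Fin.card_Iic] at h1
  rw [Fin.card_Iio] at h2
  omega

lemma card_comp_equiv {ι κ : Type*} [Fintype ι] [Fintype κ] (e : ι ≃ κ) (u : κ → ℝ) (c : ℝ) :
    Fintype.card {i // u (e i) ≤ c} = Fintype.card {k // u k ≤ c} :=
  Fintype.card_congr (e.subtypeEquiv fun _ => Iff.rfl)

lemma sub_le_apply_of_card_le {N : ℕ} {u v : Fin N → ℝ} (hu : Monotone u) (hv : Monotone v)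
    {δ : ℝ} {k : Fin N}
    (h : Fintype.card {i // -u i ≤ -u k} ≤ Fintype.card {i // -v i ≤ -u k + δ}) :
    u k - δ ≤ v k := by
  have := apply_le_add_of_card_le (u := fun i => -u i.rev) (v := fun i => -v i.rev) (k := k.rev)
    (δ := δ) (fun i j hij => neg_le_neg (hu (Fin.rev_le_rev.mpr hij)))
    (fun i j hij => neg_le_neg (hv (Fin.rev_le_rev.mpr hij))) (by
      rw [← card_comp_equiv Fin.revPerm, ← card_comp_equiv Fin.revPerm (fun i => -v i)] at h
      simpa only [Fin.rev_rev, Fin.revPerm_apply] using h)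
  simp only [Fin.rev_rev] at this
  linarith

lemma abs_sub_le_of_card_le {ι κ : Type*} [Fintype ι] [Fintype κ] {N : ℕ} {u : ι → ℝ} {v : κ → ℝ}
    {δ : ℝ}
    (hle : ∀ c, Fintype.card {i // u i ≤ c} ≤ Fintype.card {k // v k ≤ c + δ})
    (hge : ∀ c, Fintype.card {i // -u i ≤ c} ≤ Fintype.card {k // -v k ≤ c + δ})
    (e : Fin N ≃ ι) (e' : Fin N ≃ κ) (hu : Monotone (u ∘ e)) (hv : Monotone (v ∘ e'))
    (k : Fin N) : |v (e' k) - u (e k)| ≤ δ := by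
  have h1 := apply_le_add_of_card_le hu hv (δ := δ) (k := k) (by
    have := hle (u (e k))
    rwa [← card_comp_equiv e, ← card_comp_equiv e'] at this)
  have h2 := sub_le_apply_of_card_le hu hv (δ := δ) (k := k) (by
    have := hge (-u (e k))
    rwa [← card_comp_equiv e fun i => -u i, ← card_comp_equiv e' fun i => -v i] at this)
  simp only [Function.comp_apply] at h1 h2
  rw [abs_le]
  constructor <;> linarith

lemma exists_equiv_abs_sub_le {ι κ : Type*} [Fintype ι] [Fintype κ]
    (hcard : Fintype.card ι = Fintype.card κ) {u : ι → ℝ} {v : κ → ℝ} {δ : ℝ}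
    (hle : ∀ c, Fintype.card {i // u i ≤ c} ≤ Fintype.card {k // v k ≤ c + δ})
    (hge : ∀ c, Fintype.card {i // -u i ≤ c} ≤ Fintype.card {k // -v k ≤ c + δ}) :
    ∃ e : ι ≃ κ, ∀ i, |v (e i) - u i| ≤ δ := by
  let p := (Fintype.equivFin ι).symm
  let q := (Fintype.equivFinOfCardEq hcard.symm).symm
  let p' := (Tuple.sort (u ∘ p)).trans p
  let q' := (Tuple.sort (v ∘ q)).trans q
  refine ⟨p'.symm.trans q', fun i => ?_⟩
  have := abs_sub_le_of_card_le hle hge p' q' (Tuple.monotone_sort (u ∘ p))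
    (Tuple.monotone_sort (v ∘ q)) (p'.symm i)
  simpa using this

lemma card_sum_elim_le {α β : Type*} [Fintype α] [Fintype β] (w : α ⊕ β → ℝ) (c : ℝ) :
    Fintype.card {k // w k ≤ c} =
      Fintype.card {i // w (Sum.inl i) ≤ c} + Fintype.card {j // w (Sum.inr j) ≤ c} := by
  rw [← Fintype.card_sum]
  exact Fintype.card_congr Equiv.subtypeSum

end counting

section
variable {α β ι : Type*} [Fintype α] [Fintype β] [Fintype ι]

lemma sub_le_abs_sub_add {x y D δ : ℝ} (hδ : 0 ≤ δ) (h : D ≤ |x - y|) :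
    D - δ ≤ |y - (x + δ)| := by
  rw [le_abs'] at h ⊢
  rcases h with h | h
  · right; linarith
  · left; linarith

lemma card_le_card_of_gap {t : ι → ℝ} {a : α → ℝ} {d : β → ℝ} {e : α ⊕ β ≃ ι} {b c c' r : ℝ}
    (he : ∀ j, |t (e (Sum.inr j)) - d j| ≤ b) (hbr : b < r) (hgap : ∀ j, r ≤ |d j - c'|)
    (h : Fintype.card {i // a i ≤ c} + Fintype.card {j // d j ≤ c'} ≤
      Fintype.card {i // t i ≤ c'}) :
    Fintype.card {i // a i ≤ c} ≤ Fintype.card {i // t (e (Sum.inl i)) ≤ c'} := by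
  rw [← card_comp_equiv e, card_sum_elim_le] at h
  have : Fintype.card {j // t (e (Sum.inr j)) ≤ c'} ≤ Fintype.card {j // d j ≤ c'} := by
    refine Fintype.card_subtype_mono _ _ fun j hj => ?_
    have h1 := abs_le.mp (he j)
    rcases le_abs'.mp (hgap j) with h2 | h2 <;> linarith
  omega

end

section
variable {n m : ℕ}

/-- The isomorphism between pairs of vectors and vectors in block form. -/
def blockVec (n m : ℕ) : EuclideanSpace ℂ (Fin n) × EuclideanSpace ℂ (Fin m) →ₗ[ℂ]
    EuclideanSpace ℂ (Fin n ⊕ Fin m) where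
  toFun p := WithLp.toLp 2 (Sum.elim p.1 p.2)
  map_add' p q := by ext (i | i) <;> simp
  map_smul' r p := by ext (i | i) <;> simp

lemma norm_sq_blockVec (x : EuclideanSpace ℂ (Fin n)) (y : EuclideanSpace ℂ (Fin m)) :
    ‖blockVec n m (x, y)‖ ^ 2 = ‖x‖ ^ 2 + ‖y‖ ^ 2 := by
  simp [EuclideanSpace.norm_sq_eq, blockVec]

lemma inner_blockVec (x x' : EuclideanSpace ℂ (Fin n)) (y y' : EuclideanSpace ℂ (Fin m)) :
    ⟪blockVec n m (x, y), blockVec n m (x', y')⟫_ℂ = ⟪x, x'⟫_ℂ + ⟪y, y'⟫_ℂ := by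
  simp [PiLp.inner_apply, blockVec]

lemma toEuclideanLin_fromBlocks_blockVec (A : Matrix (Fin n) (Fin n) ℂ)
    (B : Matrix (Fin n) (Fin m) ℂ) (C : Matrix (Fin m) (Fin n) ℂ) (D : Matrix (Fin m) (Fin m) ℂ)
    (x : EuclideanSpace ℂ (Fin n)) (y : EuclideanSpace ℂ (Fin m)) :
    toEuclideanLin (fromBlocks A B C D) (blockVec n m (x, y)) =
      blockVec n m (toEuclideanLin A x + toEuclideanLin B y,
        toEuclideanLin C x + toEuclideanLin D y) := by
  ext (i | i) <;> simp [blockVec, fromBlocks_mulVec, toLpLin_apply, Function.comp_def]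

lemma toEuclideanLin_eigenvectorBasis {N : Type*} [Fintype N] [DecidableEq N] {A : Matrix N N ℂ}
    (hA : A.IsHermitian) (i : N) :
    toEuclideanLin A (hA.eigenvectorBasis i) =
      (hA.eigenvalues i : ℂ) • hA.eigenvectorBasis i := by
  ext j
  simpa [toLpLin_apply] using congrFun (hA.mulVec_eigenvectorBasis i) j

lemma norm_toEuclideanLin_lower_le (B : Matrix (Fin n) (Fin m) ℂ) (C : Matrix (Fin m) (Fin n) ℂ)
    (x : EuclideanSpace ℂ (Fin n)) :
    ‖toEuclideanLin C x‖ ≤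
      opNorm (fromBlocks (0 : Matrix (Fin n) (Fin n) ℂ) B C 0) * ‖x‖ := by
  have h := (LinearMap.toContinuousLinearMap (toEuclideanLin
    (fromBlocks (0 : Matrix (Fin n) (Fin n) ℂ) B C 0))).le_opNorm (blockVec n m (x, 0))
  have h1 : ∀ z : EuclideanSpace ℂ (Fin n), ‖blockVec n m (z, 0)‖ = ‖z‖ := fun z => by
    rw [← sq_eq_sq₀ (norm_nonneg _) (norm_nonneg _), norm_sq_blockVec]; simp
  have h2 : ∀ z : EuclideanSpace ℂ (Fin m), ‖blockVec n m (0, z)‖ = ‖z‖ := fun z => by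
    rw [← sq_eq_sq₀ (norm_nonneg _) (norm_nonneg _), norm_sq_blockVec]; simp
  rw [LinearMap.coe_toContinuousLinearMap', toEuclideanLin_fromBlocks_blockVec] at h
  simpa [h1, h2, opNorm] using h

lemma isBlockForm_fromBlocks (A : Matrix (Fin n) (Fin n) ℂ) (B : Matrix (Fin n) (Fin m) ℂ)
    (C : Matrix (Fin m) (Fin n) ℂ) (D : Matrix (Fin m) (Fin m) ℂ) (hBC : Cᴴ = B) :
    IsBlockForm (blockVec n m) (toEuclideanLin (fromBlocks A B C D)) (toEuclideanLin A)
      (toEuclideanLin D) (toEuclideanLin C) where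
  norm_sq := norm_sq_blockVec
  re_inner x y := by
    have h : (⟪x, toEuclideanLin B y⟫_ℂ).re = (⟪y, toEuclideanLin C x⟫_ℂ).re := by
      rw [← hBC, toEuclideanLin_conjTranspose_eq_adjoint, LinearMap.adjoint_inner_right]
      exact inner_re_symm (𝕜 := ℂ) _ _
    rw [toEuclideanLin_fromBlocks_blockVec, inner_blockVec]
    simp only [inner_add_right, Complex.add_re, h]
    ring

lemma opNorm_pos {N : Type*} [Fintype N] [DecidableEq N] {M : Matrix N N ℂ} (hM : M ≠ 0) :
    0 < opNorm M := by
  rw [opNorm, norm_pos_iff]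
  simpa using hM

end


/-- Near-degenerate perturbation theory: for a block diagonal Hermitian `A` and an
off-diagonal Hermitian perturbation `B` with `dist(σ(A₁₁), σ(A₂₂)) = Δ ≥ 3‖B‖`, the matrix
`A + B` has exactly `n` eigenvalues in `D = {μ : dist(μ, σ(A₁₁)) < 2‖B‖}`, and listing these
eigenvalues and the eigenvalues of `A₁₁` in increasing order with multiplicity, the `i`-th
ones differ by at most `‖B‖²/(Δ − 2‖B‖)`. -/
theorem near_degenerate_perturbation (n m : ℕ) (hn : 0 < n) (hm : 0 < m)
    (A11 : Matrix (Fin n) (Fin n) ℂ) (A22 : Matrix (Fin m) (Fin m) ℂ)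
    (B12 : Matrix (Fin n) (Fin m) ℂ) (B21 : Matrix (Fin m) (Fin n) ℂ)
    (hA11 : A11.IsHermitian) (hA22 : A22.IsHermitian)
    (hB : (fromBlocks (0 : Matrix (Fin n) (Fin n) ℂ) B12 B21 0).IsHermitian)
    (hBne : fromBlocks (0 : Matrix (Fin n) (Fin n) ℂ) B12 B21 0 ≠ 0)
    (hAB : (fromBlocks A11 0 0 A22 + fromBlocks 0 B12 B21 0).IsHermitian)
    (Δ : ℝ)
    (hΔdef : Δ = ⨅ (i : Fin n) (j : Fin m), |hA11.eigenvalues i - hA22.eigenvalues j|)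
    (hgap : 3 * opNorm (fromBlocks (0 : Matrix (Fin n) (Fin n) ℂ) B12 B21 0) ≤ Δ) :
    ∃ f : Fin n → (Fin n ⊕ Fin m), Function.Injective f ∧
      (∀ i : Fin n ⊕ Fin m,
        ((∃ j : Fin n, |hAB.eigenvalues i - hA11.eigenvalues j| <
            2 * opNorm (fromBlocks (0 : Matrix (Fin n) (Fin n) ℂ) B12 B21 0)) ↔
          i ∈ Set.range f)) ∧
      (∀ μs lams : Fin n → ℝ, Monotone μs → Monotone lams →
        (∃ g : Equiv.Perm (Fin n), ∀ i, μs i = hAB.eigenvalues (f (g i))) →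
        (∃ g : Equiv.Perm (Fin n), ∀ i, lams i = hA11.eigenvalues (g i)) →
        ∀ i, |μs i - lams i| ≤
          (opNorm (fromBlocks (0 : Matrix (Fin n) (Fin n) ℂ) B12 B21 0)) ^ 2 /
            (Δ - 2 * opNorm (fromBlocks (0 : Matrix (Fin n) (Fin n) ℂ) B12 B21 0))) := by
  have hconj : B21ᴴ = B12 := by
    have := hB
    rw [isHermitian_fromBlocks_iff] at this
    rw [← this.2.1, conjTranspose_conjTranspose]
  have hb := opNorm_pos hBne
  have hC := norm_toEuclideanLin_lower_le B12 B21
  set b := opNorm (fromBlocks (0 : Matrix (Fin n) (Fin n) ℂ) B12 B21 0)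
  have hsep : ∀ i j, Δ ≤ |hA11.eigenvalues i - hA22.eigenvalues j| := fun i j => by
    rw [hΔdef]
    exact (ciInf_le (Set.finite_range _).bddBelow i).trans
      (ciInf_le (Set.finite_range _).bddBelow j)
  have hform : IsBlockForm (blockVec n m)
      (toEuclideanLin (fromBlocks A11 0 0 A22 + fromBlocks 0 B12 B21 0))
      (toEuclideanLin A11) (toEuclideanLin A22) (toEuclideanLin B21) := by
    simpa [fromBlocks_add] using isBlockForm_fromBlocks A11 B12 B21 A22 hconj
  have hT := toEuclideanLin_eigenvectorBasis hAB
  have hA₁ := toEuclideanLin_eigenvectorBasis hA11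
  have hA₂ := toEuclideanLin_eigenvectorBasis hA22
  have hT' : ∀ i, (-toEuclideanLin (fromBlocks A11 0 0 A22 + fromBlocks 0 B12 B21 0))
      (hAB.eigenvectorBasis i) = ((-hAB.eigenvalues i : ℝ) : ℂ) • hAB.eigenvectorBasis i :=
    fun i => by rw [LinearMap.neg_apply, hT]; simp
  have hA₁' : ∀ i, (-toEuclideanLin A11) (hA11.eigenvectorBasis i) =
      ((-hA11.eigenvalues i : ℝ) : ℂ) • hA11.eigenvectorBasis i := fun i => by simp [hA₁]
  have hA₂' : ∀ i, (-toEuclideanLin A22) (hA22.eigenvectorBasis i) =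
      ((-hA22.eigenvalues i : ℝ) : ℂ) • hA22.eigenvectorBasis i := fun i => by simp [hA₂]
  have hC' : ∀ x, ‖(-toEuclideanLin B21) x‖ ≤ b * ‖x‖ := fun x => by simpa using hC x
  have hsymm : (toEuclideanLin A22).IsSymmetric := isSymmetric_toEuclideanLin_iff.mpr hA22
  have hsymm' : (-toEuclideanLin A22).IsSymmetric := fun x y => by
    simpa using hsymm x y
  obtain ⟨e, he⟩ := exists_equiv_abs_sub_le (δ := b) rfl
    (u := Sum.elim hA11.eigenvalues hA22.eigenvalues) (v := hAB.eigenvalues)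
    (fun c => by
      rw [card_sum_elim_le]
      exact card_add_card_le_of_isBlockForm hform _ hT _ hA₁ _ hA₂ hC hb.le c)
    (fun c => by
      rw [card_sum_elim_le]
      exact card_add_card_le_of_isBlockForm hform.neg _ hT' _ hA₁' _ hA₂' hC' hb.le c)
  refine ⟨e ∘ Sum.inl, e.injective.comp Sum.inl_injective, fun i => ?_, ?_⟩
  · obtain ⟨k, rfl⟩ := e.surjective i
    have hk := he k
    rcases k with k | k
    · exact iff_of_true ⟨k, hk.trans_lt (by linarith)⟩ ⟨k, rfl⟩
    · refine iff_of_false ?_ (by simp)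
      rintro ⟨j, hj⟩
      have h1 := hsep j k
      have h2 := abs_sub_le (hA11.eigenvalues j) (hAB.eigenvalues (e (Sum.inr k)))
        (hA22.eigenvalues k)
      rw [abs_sub_comm (hA11.eigenvalues j) (hAB.eigenvalues _)] at h2
      simp only [Sum.elim_inr] at hk
      linarith
  · rintro μs lams hμ hlam ⟨g, hg⟩ ⟨g', hg'⟩ k
    have hgap0 : 0 < Δ - 2 * b := by linarith
    set δ := b ^ 2 / (Δ - 2 * b) with hδ
    have hδ0 : 0 ≤ δ := by positivity
    have hδb : δ ≤ b := by
      rw [hδ, div_le_iff₀ hgap0]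
      nlinarith
    have heinr : ∀ j, |hAB.eigenvalues (e (Sum.inr j)) - hA22.eigenvalues j| ≤ b :=
      fun j => he (Sum.inr j)
    have hfar : ∀ i j, Δ - δ ≤ |hA22.eigenvalues j - (hA11.eigenvalues i + δ)| := fun i j =>
      sub_le_abs_sub_add hδ0 (hsep i j)
    have hfar' : ∀ i j, Δ - δ ≤ |-hA22.eigenvalues j - (-hA11.eigenvalues i + δ)| := fun i j =>
      sub_le_abs_sub_add hδ0 (by rw [neg_sub_neg, abs_sub_comm]; exact hsep i j)
    have hμeq : ∀ i, μs i = hAB.eigenvalues (e (Sum.inl (g i))) := hg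
    have h1 : ∀ i, Fintype.card {k // hA11.eigenvalues k ≤ hA11.eigenvalues i} ≤
        Fintype.card {k // hAB.eigenvalues (e (Sum.inl k)) ≤ hA11.eigenvalues i + δ} := fun i =>
      card_le_card_of_gap heinr (by linarith) (hfar i)
        (card_add_card_le_of_isBlockForm_of_gap hform _ hT _ hA₁ _ hA₂ hsymm hC hgap0
          fun j => le_trans (by linarith) (hfar i j))
    have h2 : ∀ i, Fintype.card {k // -hA11.eigenvalues k ≤ -hA11.eigenvalues i} ≤
        Fintype.card {k // -hAB.eigenvalues (e (Sum.inl k)) ≤ -hA11.eigenvalues i + δ} := fun i =>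
      card_le_card_of_gap (t := fun k => -hAB.eigenvalues k) (d := fun j => -hA22.eigenvalues j)
        (fun j => by rw [neg_sub_neg, abs_sub_comm]; exact heinr j) (by linarith) (hfar' i)
        (card_add_card_le_of_isBlockForm_of_gap hform.neg _ hT' _ hA₁' _ hA₂' hsymm' hC' hgap0
          fun j => le_trans (by linarith) (hfar' i j))
    have h3 := apply_le_add_of_card_le hlam hμ (k := k) (δ := δ) (by
      simp only [hμeq, hg']
      rw [card_comp_equiv g' hA11.eigenvalues,
        card_comp_equiv g fun i => hAB.eigenvalues (e (Sum.inl i))]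
      exact h1 (g' k))
    have h4 := sub_le_apply_of_card_le hlam hμ (k := k) (δ := δ) (by
      simp only [hμeq, hg']
      rw [card_comp_equiv g' fun i => -hA11.eigenvalues i,
        card_comp_equiv g fun i => -hAB.eigenvalues (e (Sum.inl i))]
      exact h2 (g' k))
    rw [abs_le]
    constructor <;> linarith
end
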